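/- arXiv:1511.07506 — 5 statements merged into one kernel-verified Lean document; each statement's English description precedes it below -/
import Mathlib

section
/- For every probability measures F and G on ℝ^d and every n ∈ ℕ, the n-th iterate Q_G^n(F) of the centred quadratic stochastic operator equals the convolution of the pushforward of the 2ⁿ-fold convolution power F^{∗2ⁿ} under x ↦ x/2ⁿ with the convolutions, over j = 0,…,n−1, of the pushforwards of G^{∗2ʲ} under x ↦ x/2ʲ; equivalently, Q_G^n(F) is the law of (X₁+⋯+X_{2ⁿ})/2ⁿ + Σ_{j=0}^{n-1} (Y₁⁽ʲ⁾+⋯+Y_{2ʲ}⁽ʲ⁾)/2ʲ, where all the X's and Y's are independent, the X's are i.i.d. with law F and the Y's are i.i.d. with law G. -/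
open MeasureTheory Filter Topology

/-- The centred quadratic stochastic operator `Q_G(F) = Ḟ ∗ Ḟ ∗ G`, where `Ḟ` is the
pushforward of `F` under `x ↦ x/2`. -/
noncomputable def cqso {d : ℕ} (G F : Measure (EuclideanSpace ℝ (Fin d))) :
    Measure (EuclideanSpace ℝ (Fin d)) :=
  ((F.map (fun x => (2 : ℝ)⁻¹ • x)).conv (F.map (fun x => (2 : ℝ)⁻¹ • x))).conv G

/-- `convPow F k` is the `k`-fold convolution power `F^{∗k}` (with `F^{∗0} = δ₀`). -/
noncomputable def convPow {d : ℕ} (F : Measure (EuclideanSpace ℝ (Fin d))) :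
    ℕ → Measure (EuclideanSpace ℝ (Fin d))
  | 0 => Measure.dirac 0
  | k + 1 => (convPow F k).conv F

/-- `convSeq μ n` is the convolution `μ 0 ∗ μ 1 ∗ ⋯ ∗ μ (n-1)`. -/
noncomputable def convSeq {d : ℕ} (μ : ℕ → Measure (EuclideanSpace ℝ (Fin d))) :
    ℕ → Measure (EuclideanSpace ℝ (Fin d))
  | 0 => Measure.dirac 0
  | n + 1 => (convSeq μ n).conv (μ n)

instance cqso_isProb {d : ℕ} (G F : Measure (EuclideanSpace ℝ (Fin d)))
    [IsProbabilityMeasure F] [IsProbabilityMeasure G] : IsProbabilityMeasure (cqso G F) := by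
  have : IsProbabilityMeasure (F.map (fun x => (2 : ℝ)⁻¹ • x)) :=
    Measure.isProbabilityMeasure_map (by fun_prop)
  unfold cqso
  infer_instance

instance convPow_isProb {d : ℕ} (F : Measure (EuclideanSpace ℝ (Fin d)))
    [IsProbabilityMeasure F] (k : ℕ) : IsProbabilityMeasure (convPow F k) := by
  induction k with
  | zero => unfold convPow; infer_instance
  | succ k ih => unfold convPow; infer_instance

lemma convSeq_isProb {d : ℕ} (μ : ℕ → Measure (EuclideanSpace ℝ (Fin d)))
    [∀ i, IsProbabilityMeasure (μ i)] (k : ℕ) : IsProbabilityMeasure (convSeq μ k) := by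
  induction k with
  | zero => unfold convSeq; infer_instance
  | succ k ih => unfold convSeq; infer_instance

lemma charFun_convPow {d : ℕ} (F : Measure (EuclideanSpace ℝ (Fin d)))
    [IsProbabilityMeasure F] (k : ℕ) (t : EuclideanSpace ℝ (Fin d)) :
    charFun (convPow F k) t = charFun F t ^ k := by
  induction k with
  | zero => simp [convPow, charFun_dirac]
  | succ k ih => rw [convPow, charFun_conv, ih, pow_succ]

lemma charFun_convSeq {d : ℕ} (μ : ℕ → Measure (EuclideanSpace ℝ (Fin d)))
    [∀ i, IsProbabilityMeasure (μ i)] (k : ℕ) (t : EuclideanSpace ℝ (Fin d)) :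
    charFun (convSeq μ k) t = ∏ j ∈ Finset.range k, charFun (μ j) t := by
  induction k with
  | zero => simp [convSeq, charFun_dirac]
  | succ k ih =>
    have := convSeq_isProb μ k
    rw [convSeq, charFun_conv, ih, Finset.prod_range_succ]

lemma charFun_cqso {d : ℕ} (G F : Measure (EuclideanSpace ℝ (Fin d)))
    [IsProbabilityMeasure F] [IsProbabilityMeasure G] (t : EuclideanSpace ℝ (Fin d)) :
    charFun (cqso G F) t = charFun F ((2 : ℝ)⁻¹ • t) ^ 2 * charFun G t := by
  have : IsProbabilityMeasure (F.map (fun x => (2 : ℝ)⁻¹ • x)) :=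
    Measure.isProbabilityMeasure_map (by fun_prop)
  rw [cqso, charFun_conv, charFun_conv, charFun_map_smul, pow_two]

lemma iterate_isProb {d : ℕ} (G F : Measure (EuclideanSpace ℝ (Fin d)))
    [IsProbabilityMeasure F] [IsProbabilityMeasure G] (n : ℕ) :
    IsProbabilityMeasure ((cqso G)^[n] F) := by
  induction n with
  | zero => simpa
  | succ n ih => rw [Function.iterate_succ_apply']; infer_instance

lemma charFun_iterate {d : ℕ} (G : Measure (EuclideanSpace ℝ (Fin d)))
    [IsProbabilityMeasure G] (n : ℕ) (t : EuclideanSpace ℝ (Fin d)) :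
    ∀ (F : Measure (EuclideanSpace ℝ (Fin d))) [IsProbabilityMeasure F],
    charFun ((cqso G)^[n] F) t = charFun F (((2 : ℝ) ^ n)⁻¹ • t) ^ (2 ^ n) *
      ∏ j ∈ Finset.range n, charFun G (((2 : ℝ) ^ j)⁻¹ • t) ^ (2 ^ j) := by
  induction n with
  | zero => intro F _; simp
  | succ n ih =>
    intro F _
    rw [Function.iterate_succ_apply, ih, charFun_cqso, Finset.prod_range_succ, smul_smul,
      ← mul_inv, ← pow_succ', mul_pow, ← pow_mul, ← pow_succ']
    ring

/-- The `n`-th iterate of the centred QSO applied to `F` is the law of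
`(X₁+⋯+X_{2ⁿ})/2ⁿ + Σ_{j<n} (Y₁⁽ʲ⁾+⋯+Y_{2ʲ}⁽ʲ⁾)/2ʲ`, i.e. the convolution of the pushforward
of `F^{∗2ⁿ}` under `x ↦ x/2ⁿ` with the convolutions over `j < n` of the pushforwards of
`G^{∗2ʲ}` under `x ↦ x/2ʲ`. -/
theorem cqso_iterate_eq {d : ℕ} (F G : Measure (EuclideanSpace ℝ (Fin d)))
    [IsProbabilityMeasure F] [IsProbabilityMeasure G] (n : ℕ) :
    (cqso G)^[n] F =
      ((convPow F (2 ^ n)).map (fun x => ((2 : ℝ) ^ n)⁻¹ • x)).conv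
        (convSeq (fun j => (convPow G (2 ^ j)).map (fun x => ((2 : ℝ) ^ j)⁻¹ • x)) n) := by
  have hF : IsProbabilityMeasure ((convPow F (2 ^ n)).map (fun x => ((2 : ℝ) ^ n)⁻¹ • x)) :=
    Measure.isProbabilityMeasure_map (by fun_prop)
  have hG : ∀ j : ℕ, IsProbabilityMeasure
      ((fun j => (convPow G (2 ^ j)).map (fun x => ((2 : ℝ) ^ j)⁻¹ • x)) j) := fun j =>
    Measure.isProbabilityMeasure_map (by fun_prop)
  have h1 := iterate_isProb G F n
  have h2 := convSeq_isProb (fun j => (convPow G (2 ^ j)).map (fun x => ((2 : ℝ) ^ j)⁻¹ • x)) n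
  apply Measure.ext_of_charFun
  funext t
  rw [charFun_iterate, charFun_conv, charFun_convSeq, charFun_map_smul, charFun_convPow]
  simp only [charFun_map_smul, charFun_convPow]
end

section
/- Let G be a probability measure on ℝ^d with finite second moments and mean zero, ∫ x dG(x) = 0. Then the sequence of probability measures G⁽ⁿ⁾ := Q_G^n(δ₀) (whose characteristic functions are φ_{G⁽ⁿ⁾}(s) = ∏_{j=0}^{n-1} (φ_G(s/2ʲ))^{2ʲ}) converges weakly to a probability measure G⁽∞⁾ on ℝ^d. -/
open MeasureTheory Filter Topology

/-- Weak convergence of a sequence of measures. -/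
def WeakTendsto {E : Type*} [MeasurableSpace E] [TopologicalSpace E]
    (μ : ℕ → Measure E) (ν : Measure E) : Prop :=
  ∀ f : BoundedContinuousFunction E ℝ,
    Tendsto (fun n => ∫ x, f x ∂(μ n)) atTop (𝓝 (∫ x, f x ∂ν))

lemma aux_exp_bound (y : ℝ) :
    ‖Complex.exp (y * Complex.I) - 1 - y * Complex.I‖ ≤ 3 * y ^ 2 := by
  have hn : ‖(y : ℂ) * Complex.I‖ = |y| := by simp
  rcases le_total |y| 1 with h | h
  · have := Complex.norm_exp_sub_one_sub_id_le (x := y * Complex.I) (by rw [hn]; exact h)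
    rw [hn, sq_abs] at this
    nlinarith [sq_nonneg y]
  · have h1 : ‖Complex.exp (y * Complex.I) - 1 - y * Complex.I‖ ≤ 1 + 1 + |y| := by
      refine (norm_sub_le _ _).trans ?_
      rw [hn]
      gcongr
      refine (norm_sub_le _ _).trans ?_
      rw [Complex.norm_exp_ofReal_mul_I]
      simp
    have : y ^ 2 = |y| ^ 2 := (sq_abs y).symm
    nlinarith

lemma aux_charFun_bound {d : ℕ} (G : Measure (EuclideanSpace ℝ (Fin d)))
    [IsProbabilityMeasure G]
    (hG2 : Integrable (fun x => ‖x‖ ^ 2) G)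
    (hGmean : ∫ x, x ∂G = 0) (t : EuclideanSpace ℝ (Fin d)) :
    ‖charFun G t - 1‖ ≤ (3 * ∫ x, ‖x‖ ^ 2 ∂G) * ‖t‖ ^ 2 := by
  have hid : Integrable (fun x : EuclideanSpace ℝ (Fin d) => x) G := by
    refine Integrable.mono' (g := fun x => 1 + ‖x‖ ^ 2) ((integrable_const 1).add hG2)
      (by fun_prop) (ae_of_all _ fun x => ?_)
    nlinarith [sq_nonneg (‖x‖ - 1), norm_nonneg x]
  have hin : Integrable (fun x : EuclideanSpace ℝ (Fin d) => inner ℝ x t) G := hid.inner_const t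
  have hin0 : ∫ x, inner ℝ x t ∂G = 0 := by
    have := integral_inner (𝕜 := ℝ) hid t
    simp_rw [real_inner_comm t]
    rw [this, hGmean, inner_zero_right]
  have hinC : Integrable (fun x : EuclideanSpace ℝ (Fin d) =>
      ((inner ℝ x t : ℝ) : ℂ) * Complex.I) G := hin.ofReal.mul_const _
  have hinC0 : ∫ x, ((inner ℝ x t : ℝ) : ℂ) * Complex.I ∂G = 0 := by
    rw [integral_mul_const, integral_complex_ofReal, hin0]; simp
  have hexp : Integrable (fun x : EuclideanSpace ℝ (Fin d) =>
      Complex.exp (((inner ℝ x t : ℝ) : ℂ) * Complex.I)) G := by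
    refine Integrable.mono' (g := fun _ => 1) (integrable_const 1) 
      (by fun_prop) (ae_of_all _ fun x => ?_)
    rw [Complex.norm_exp_ofReal_mul_I]
  have heq : charFun G t - 1 = ∫ x, (Complex.exp (((inner ℝ x t : ℝ) : ℂ) * Complex.I) - 1
      - ((inner ℝ x t : ℝ) : ℂ) * Complex.I) ∂G := by
    have hexp1 : Integrable (fun x : EuclideanSpace ℝ (Fin d) =>
      Complex.exp (((inner ℝ x t : ℝ) : ℂ) * Complex.I) - 1) G := hexp.sub (integrable_const 1)
    rw [integral_sub hexp1 hinC, hinC0,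
      integral_sub hexp (integrable_const 1), charFun_apply]
    simp
  rw [heq]
  have : (3 * ∫ x, ‖x‖ ^ 2 ∂G) * ‖t‖ ^ 2 = ∫ x, 3 * ‖t‖ ^ 2 * ‖x‖ ^ 2 ∂G := by
    rw [integral_const_mul]; ring
  rw [this]
  refine norm_integral_le_of_norm_le (hG2.const_mul _) (ae_of_all _ fun x => ?_)
  refine (aux_exp_bound _).trans ?_
  have h := abs_real_inner_le_norm x t
  have h2 : (inner ℝ x t : ℝ) ^ 2 ≤ (‖x‖ * ‖t‖) ^ 2 := by
    rw [← sq_abs]; gcongr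
  nlinarith

lemma aux_prob {d : ℕ} (G : Measure (EuclideanSpace ℝ (Fin d)))
    [IsProbabilityMeasure G] (n : ℕ) :
    IsProbabilityMeasure ((cqso G)^[n] (Measure.dirac 0)) := by
  induction n with
  | zero => simp only [Function.iterate_zero, id]; infer_instance
  | succ n ih =>
    rw [Function.iterate_succ_apply', cqso]
    have := Measure.isProbabilityMeasure_map (μ := (cqso G)^[n] (Measure.dirac 0))
      (f := fun x => (2 : ℝ)⁻¹ • x) (by fun_prop)
    infer_instance

lemma aux_rec {d : ℕ} (G : Measure (EuclideanSpace ℝ (Fin d)))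
    [IsProbabilityMeasure G] (n : ℕ) (t : EuclideanSpace ℝ (Fin d)) :
    charFun ((cqso G)^[n+1] (Measure.dirac 0)) t =
      charFun ((cqso G)^[n] (Measure.dirac 0)) ((2 : ℝ)⁻¹ • t) ^ 2 * charFun G t := by
  have := aux_prob G n
  rw [Function.iterate_succ_apply', cqso]
  have := Measure.isProbabilityMeasure_map (μ := (cqso G)^[n] (Measure.dirac 0))
      (f := fun x => (2 : ℝ)⁻¹ • x) (by fun_prop)
  rw [charFun_conv, charFun_conv, charFun_map_smul, sq]

lemma aux_step {d : ℕ} (G : Measure (EuclideanSpace ℝ (Fin d)))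
    [IsProbabilityMeasure G] (K : ℝ)
    (hK : ∀ t, ‖charFun G t - 1‖ ≤ K * ‖t‖ ^ 2) (n : ℕ) :
    ∀ t : EuclideanSpace ℝ (Fin d),
    ‖charFun ((cqso G)^[n+1] (Measure.dirac 0)) t - charFun ((cqso G)^[n] (Measure.dirac 0)) t‖
      ≤ K * ‖t‖ ^ 2 * (1 / 2) ^ n := by
  induction n with
  | zero =>
    intro t
    rw [aux_rec]
    simpa [charFun_dirac] using hK t
  | succ n ih =>
    intro t
    rw [aux_rec G (n+1) t, aux_rec G n t]
    have h := ih ((2 : ℝ)⁻¹ • t)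
    have := aux_prob G n
    have := aux_prob G (n+1)
    have ha := norm_charFun_le_one (μ := (cqso G)^[n+1] (Measure.dirac 0)) ((2 : ℝ)⁻¹ • t)
    have hb := norm_charFun_le_one (μ := (cqso G)^[n] (Measure.dirac 0)) ((2 : ℝ)⁻¹ • t)
    have hc := norm_charFun_le_one (μ := G) t
    set a := charFun ((cqso G)^[n+1] (Measure.dirac 0)) ((2 : ℝ)⁻¹ • t)
    set b := charFun ((cqso G)^[n] (Measure.dirac 0)) ((2 : ℝ)⁻¹ • t)
    have e : a ^ 2 * charFun G t - b ^ 2 * charFun G t = (a - b) * (a + b) * charFun G t := by ring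
    rw [e, norm_mul, norm_mul]
    have hab : ‖a + b‖ ≤ 2 := (norm_add_le _ _).trans (by linarith)
    calc ‖a - b‖ * ‖a + b‖ * ‖charFun G t‖ ≤ ‖a - b‖ * 2 * 1 := by gcongr
      _ ≤ (K * ‖(2 : ℝ)⁻¹ • t‖ ^ 2 * (1 / 2) ^ n) * 2 * 1 := by gcongr
      _ = K * ‖t‖ ^ 2 * (1 / 2) ^ (n + 1) := by
        rw [norm_smul]; norm_num; ring

theorem cqso_dirac_weak_limit {d : ℕ} (G : Measure (EuclideanSpace ℝ (Fin d)))
    [IsProbabilityMeasure G]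
    (hG2 : Integrable (fun x => ‖x‖ ^ 2) G)
    (hGmean : ∫ x, x ∂G = 0) :
    ∃ Ginf : Measure (EuclideanSpace ℝ (Fin d)),
      IsProbabilityMeasure Ginf ∧
      WeakTendsto (fun n => (cqso G)^[n] (Measure.dirac 0)) Ginf := by
  obtain ⟨K, hK⟩ : ∃ K : ℝ, ∀ t, ‖charFun G t - 1‖ ≤ K * ‖t‖ ^ 2 :=
    ⟨_, aux_charFun_bound G hG2 hGmean⟩
  have hstep := aux_step G K hK
  have hprob := aux_prob G
  have hd : ∀ t : EuclideanSpace ℝ (Fin d), ∀ n,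
      dist (charFun ((cqso G)^[n] (Measure.dirac 0)) t)
        (charFun ((cqso G)^[n+1] (Measure.dirac 0)) t) ≤ K * ‖t‖ ^ 2 * (1 / 2) ^ n := by
    intro t n
    rw [dist_comm, dist_eq_norm]
    exact hstep n t
  have hlim : ∀ t : EuclideanSpace ℝ (Fin d), ∃ z, Tendsto
      (fun n => charFun ((cqso G)^[n] (Measure.dirac 0)) t) atTop (𝓝 z) := fun t =>
    cauchySeq_tendsto_of_complete (cauchySeq_of_le_geometric _ _ (by norm_num) (hd t))
  choose f hf using hlim
  have hf1 : ∀ t, dist 1 (f t) ≤ K * ‖t‖ ^ 2 / (1 - 1 / 2) := by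
    intro t
    have := dist_le_of_le_geometric_of_tendsto₀ _ _ (by norm_num) (hd t) (hf t)
    simpa [charFun_dirac] using this
  have hf0 : f 0 = 1 := by
    have := hf1 0
    simp at this
    exact this.symm
  have hcont : ContinuousAt f 0 := by
    rw [ContinuousAt, hf0, tendsto_iff_dist_tendsto_zero]
    refine squeeze_zero (fun _ => dist_nonneg) (fun t => (dist_comm (f t) 1).trans_le (hf1 t)) ?_
    have : Continuous fun t : EuclideanSpace ℝ (Fin d) => K * ‖t‖ ^ 2 / (1 - 1 / 2) := by fun_prop
    simpa using this.tendsto 0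
  have htight := isTightMeasureSet_of_tendsto_charFun hcont hf
  let μ : ℕ → ProbabilityMeasure (EuclideanSpace ℝ (Fin d)) := fun n => ⟨_, hprob n⟩
  have hcomp : IsCompact (closure (Set.range μ)) := by
    refine isCompact_closure_of_isTightMeasureSet ?_
    convert! htight using 1
    ext ν
    constructor
    · rintro ⟨_, ⟨n, rfl⟩, rfl⟩
      exact ⟨n, rfl⟩
    · rintro ⟨n, rfl⟩
      exact ⟨μ n, ⟨n, rfl⟩, rfl⟩
  obtain ⟨ν, -, hν⟩ := hcomp.ultrafilter_le_nhds ((hyperfilter ℕ).map μ)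
    (.trans (by simp) (monotone_principal subset_closure))
  have hν' : Tendsto μ (hyperfilter ℕ) (𝓝 ν) := hν
  have hU : (hyperfilter ℕ : Filter ℕ) ≤ atTop := Nat.hyperfilter_le_atTop
  have hfν : ∀ t, charFun (ν : Measure (EuclideanSpace ℝ (Fin d))) t = f t := by
    intro t
    refine tendsto_nhds_unique ?_ ((hf t).mono_left hU)
    rw [ProbabilityMeasure.tendsto_iff_forall_integral_rclike_tendsto ℂ] at hν'
    simp_rw [charFun_eq_integral_innerProbChar]
    exact hν' (BoundedContinuousFunction.innerProbChar t)
  refine ⟨ν, inferInstance, ?_⟩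
  have hT : Tendsto μ atTop (𝓝 ν) :=
    ProbabilityMeasure.tendsto_of_tendsto_charFun fun t => by rw [hfν]; exact hf t
  exact ProbabilityMeasure.tendsto_iff_forall_integral_tendsto.1 hT
end

section
/- Let F be a probability measure on ℝ and for n ∈ ℕ let F⁽ⁿ⁾ denote the pushforward of the 2ⁿ-fold convolution power F^{∗2ⁿ} under x ↦ x/2ⁿ (the law of the arithmetic mean of 2ⁿ i.i.d. random variables with law F). If F⁽ⁿ⁾ converges weakly to a probability measure F⁽∞⁾, then the characteristic function of F⁽∞⁾ satisfies the equation φ_{F⁽∞⁾}(2s) = (φ_{F⁽∞⁾}(s))² for all s ∈ ℝ. -/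
open MeasureTheory Filter Topology

/-- The characteristic function of a finite Borel measure on `ℝ`. -/
noncomputable def charFnR (H : Measure ℝ) (s : ℝ) : ℂ :=
  ∫ x, Complex.exp (((s * x : ℝ) : ℂ) * Complex.I) ∂H

/-- `convPowR F k` is the `k`-fold convolution power `F^{∗k}` (with `F^{∗0} = δ₀`). -/
noncomputable def convPowR (F : Measure ℝ) : ℕ → Measure ℝ
  | 0 => Measure.dirac 0
  | k + 1 => (convPowR F k).conv F

/-- The law `F⁽ⁿ⁾` of the arithmetic mean of `2ⁿ` i.i.d. random variables with law `F`:
the pushforward of `F^{∗2ⁿ}` under `x ↦ x/2ⁿ`. -/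
noncomputable def meanLaw (F : Measure ℝ) (n : ℕ) : Measure ℝ :=
  (convPowR F (2 ^ n)).map (fun x => x / 2 ^ n)

theorem convPowR_prob (F : Measure ℝ) [IsProbabilityMeasure F] (k : ℕ) :
    IsProbabilityMeasure (convPowR F k) := by
  induction k with
  | zero => unfold convPowR; infer_instance
  | succ k ih => unfold convPowR; infer_instance

theorem charFun_convPowR (F : Measure ℝ) [IsProbabilityMeasure F] (k : ℕ) (s : ℝ) :
    charFun (convPowR F k) s = charFun F s ^ k := by
  induction k with
  | zero => simp [convPowR]
  | succ k ih =>
    have := convPowR_prob F k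
    rw [convPowR, charFun_conv, ih, pow_succ]

theorem charFnR_eq (H : Measure ℝ) (s : ℝ) : charFnR H s = charFun H s := by
  rw [charFun_apply_real, charFnR]
  simp

theorem charFun_meanLaw (F : Measure ℝ) [IsProbabilityMeasure F] (n : ℕ) (s : ℝ) :
    charFun (meanLaw F n) s = charFun F ((2 ^ n)⁻¹ * s) ^ (2 ^ n) := by
  have h : (fun x : ℝ => x / 2 ^ n) = fun x => (2 ^ n)⁻¹ * x := by
    funext x; rw [div_eq_inv_mul]
  rw [meanLaw, h, charFun_map_mul, charFun_convPowR]

theorem meanLaw_prob (F : Measure ℝ) [IsProbabilityMeasure F] (n : ℕ) :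
    IsProbabilityMeasure (meanLaw F n) := by
  have := convPowR_prob F (2 ^ n)
  exact Measure.isProbabilityMeasure_map (by fun_prop)

theorem charFn_limit_functional_eq (F Finf : Measure ℝ)
    [IsProbabilityMeasure F] [IsProbabilityMeasure Finf]
    (hconv : WeakTendsto (fun n => meanLaw F n) Finf) :
    ∀ s : ℝ, charFnR Finf (2 * s) = (charFnR Finf s) ^ 2 := by
  intro s
  have hP := meanLaw_prob F
  have key : ∀ t : ℝ, Tendsto (fun n => charFun (meanLaw F n) t) atTop (𝓝 (charFun Finf t)) := by
    let m : ℕ → ProbabilityMeasure ℝ := fun n => ⟨meanLaw F n, hP n⟩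
    let m' : ProbabilityMeasure ℝ := ⟨Finf, inferInstance⟩
    have h : Tendsto m atTop (𝓝 m') :=
      ProbabilityMeasure.tendsto_iff_forall_integral_tendsto.2 hconv
    exact ProbabilityMeasure.tendsto_iff_tendsto_charFun.1 h
  rw [charFnR_eq, charFnR_eq]
  have h1 := (key (2 * s)).comp (tendsto_add_atTop_nat 1)
  have h2 := (key s).pow 2
  refine tendsto_nhds_unique h1 (h2.congr fun n => ?_)
  simp only [Function.comp, charFun_meanLaw]
  have e : ((2 : ℝ) ^ (n + 1))⁻¹ * (2 * s) = (2 ^ n)⁻¹ * s := by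
    rw [pow_succ]; field_simp
  rw [e, ← pow_mul, ← pow_succ]
end

section
/- Let G be a symmetric probability measure on ℝ (i.e. invariant under x ↦ −x) whose tails satisfy, for some constant C > 0, G([x,∞)) = C x^{−1} + o(x^{−1}) as x → ∞. Then for every s ∈ ℝ, lim_{n→∞} (φ_G(s/n))ⁿ = exp(−C π |s|). -/
open MeasureTheory Filter Topology Asymptotics Real

lemma aux_inner (M x : ℝ) :
    ∫ u in (0:ℝ)..M, Real.sin u * Real.exp (-(u * x)) =
      (1 + x^2)⁻¹ - Real.exp (-(M*x)) * (Real.cos M + x * Real.sin M) * (1 + x^2)⁻¹ := by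
  have hpos : (1 + x^2) ≠ 0 := by positivity
  have hd : ∀ u ∈ Set.uIcc (0:ℝ) M, HasDerivAt
      (fun u => - (Real.exp (-(u*x)) * (Real.cos u + x * Real.sin u) * (1 + x^2)⁻¹))
      (Real.sin u * Real.exp (-(u * x))) u := by
    intro u _
    have h1 : HasDerivAt (fun u : ℝ => Real.exp (-(u*x))) (Real.exp (-(u*x)) * (-(1 * x))) u :=
      (((hasDerivAt_id u).mul_const x).neg).exp
    have h2 : HasDerivAt (fun u : ℝ => Real.cos u + x * Real.sin u)
      (-Real.sin u + x * Real.cos u) u :=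
      (Real.hasDerivAt_cos u).add ((Real.hasDerivAt_sin u).const_mul x)
    refine ((h1.mul h2).mul_const ((1 + x^2)⁻¹)).neg.congr_deriv ?_
    rw [neg_eq_iff_eq_neg, ← div_eq_mul_inv, div_eq_iff hpos]
    ring
  rw [intervalIntegral.integral_eq_sub_of_hasDerivAt hd
    (Continuous.intervalIntegrable (by fun_prop) _ _)]
  simp
  ring

lemma aux_exp_int {u : ℝ} (hu : 0 < u) : IntegrableOn (fun x => Real.exp (-(u * x))) (Set.Ioi 0) := by
  simpa using integrableOn_exp_mul_Ioi (a := -u) (by linarith) 0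

lemma aux_exp_val {u : ℝ} (hu : 0 < u) : ∫ x in Set.Ioi (0:ℝ), Real.exp (-(u * x)) = u⁻¹ := by
  have := integral_exp_mul_Ioi (a := -u) (by linarith) 0
  simp at this
  simpa [neg_div] using this

lemma aux_dirichlet (M : ℝ) (hM : 0 < M) :
    |(∫ u in Set.Ioc (0:ℝ) M, Real.sin u * u⁻¹) - π / 2| ≤ 2 / M := by
  have hint : Integrable (Function.uncurry fun (u x : ℝ) => Real.sin u * Real.exp (-(u * x)))
      ((volume.restrict (Set.Ioc (0:ℝ) M)).prod (volume.restrict (Set.Ioi (0:ℝ)))) := by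
    rw [integrable_prod_iff]
    · constructor
      · filter_upwards [ae_restrict_mem measurableSet_Ioc] with u hu
        exact (aux_exp_int hu.1).const_mul (Real.sin u)
      · have hs : IntegrableOn (fun u : ℝ => |Real.sinc u|) (Set.Ioc (0:ℝ) M) :=
          (continuous_sinc.abs).integrableOn_Ioc
        refine Integrable.congr hs ?_
        filter_upwards [ae_restrict_mem measurableSet_Ioc] with u hu
        simp only [Function.uncurry, norm_mul, Real.norm_eq_abs, Real.abs_exp]
        rw [integral_const_mul, aux_exp_val hu.1, Real.sinc_of_ne_zero hu.1.ne', abs_div,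
          abs_of_pos hu.1, div_eq_mul_inv]
    · apply Continuous.aestronglyMeasurable
      unfold Function.uncurry
      fun_prop
  have hsw := integral_integral_swap hint
  have hL : ∫ u in Set.Ioc (0:ℝ) M, Real.sin u * u⁻¹ =
      ∫ u in Set.Ioc (0:ℝ) M, ∫ x in Set.Ioi (0:ℝ), Real.sin u * Real.exp (-(u * x)) := by
    refine setIntegral_congr_fun measurableSet_Ioc fun u hu => ?_
    rw [integral_const_mul, aux_exp_val hu.1]
  have hI1 : IntegrableOn (fun x : ℝ => (1 + x^2)⁻¹) (Set.Ioi 0) :=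
    integrable_inv_one_add_sq.integrableOn
  have hbd : ∀ x ∈ Set.Ioi (0:ℝ),
      ‖Real.exp (-(M*x)) * (Real.cos M + x * Real.sin M) * (1 + x^2)⁻¹‖ ≤
        2 * Real.exp (-(M*x)) := by
    intro x hx
    have hx : 0 < x := hx
    rw [norm_mul, norm_mul, Real.norm_eq_abs, Real.abs_exp, norm_inv, mul_assoc, mul_comm]
    gcongr
    rw [← div_eq_mul_inv, div_le_iff₀ (by rw [norm_pos_iff]; positivity), Real.norm_eq_abs,
      Real.norm_eq_abs, abs_of_pos (by positivity : 0 < 1 + x^2)]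
    calc |Real.cos M + x * Real.sin M| ≤ |Real.cos M| + |x * Real.sin M| := abs_add_le _ _
      _ ≤ 1 + x * 1 := by
        rw [abs_mul, abs_of_pos hx]
        gcongr
        · exact Real.abs_cos_le_one _
        · exact Real.abs_sin_le_one _
      _ ≤ _ := by nlinarith [sq_nonneg (x - 1)]
  have hE : IntegrableOn (fun x => 2 * Real.exp (-(M*x))) (Set.Ioi 0) :=
    (aux_exp_int hM).const_mul 2
  have hI2 : IntegrableOn
      (fun x => Real.exp (-(M*x)) * (Real.cos M + x * Real.sin M) * (1 + x^2)⁻¹) (Set.Ioi 0) := by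
    refine Integrable.mono' hE (by fun_prop) ?_
    filter_upwards [ae_restrict_mem measurableSet_Ioi] with x hx using hbd x hx
  have hR : ∫ x in Set.Ioi (0:ℝ), ∫ u in Set.Ioc (0:ℝ) M, Real.sin u * Real.exp (-(u * x)) =
      π / 2 - ∫ x in Set.Ioi (0:ℝ),
        Real.exp (-(M*x)) * (Real.cos M + x * Real.sin M) * (1 + x^2)⁻¹ := by
    have h0 : ∫ x in Set.Ioi (0:ℝ), (1 + x^2)⁻¹ = π / 2 := by
      rw [integral_Ioi_inv_one_add_sq]; simp
    rw [← h0, ← integral_sub hI1 hI2]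
    refine setIntegral_congr_fun measurableSet_Ioi fun x _ => ?_
    rw [← intervalIntegral.integral_of_le hM.le, aux_inner]
  rw [hL, hsw, hR]
  have : ‖∫ x in Set.Ioi (0:ℝ),
        Real.exp (-(M*x)) * (Real.cos M + x * Real.sin M) * (1 + x^2)⁻¹‖ ≤
        ∫ x in Set.Ioi (0:ℝ), 2 * Real.exp (-(M*x)) := by
    refine norm_integral_le_of_norm_le hE ?_
    filter_upwards [ae_restrict_mem measurableSet_Ioi] with x hx using hbd x hx
  rw [integral_const_mul, aux_exp_val hM, Real.norm_eq_abs] at this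
  rw [sub_sub_cancel_left, abs_neg, div_eq_mul_inv]
  exact this

lemma aux_bound (G : Measure ℝ) [IsProbabilityMeasure G] (C : ℝ)
    (htail : (fun x : ℝ => (G (Set.Ici x)).toReal - C * x⁻¹) =o[atTop] (fun x : ℝ => x⁻¹)) :
    ∃ K : ℝ, 0 < K ∧ ∀ x : ℝ, 0 < x → (G (Set.Ici x)).toReal ≤ K * x⁻¹ := by
  have h := htail.bound (zero_lt_one)
  obtain ⟨x0, hx0⟩ := eventually_atTop.1 h
  refine ⟨max (|x0| + 1) (|C| + 1), by positivity, fun x hx => ?_⟩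
  have hxi : 0 < x⁻¹ := inv_pos.2 hx
  rcases le_total x0 x with hle | hle
  · have := hx0 x hle
    rw [Real.norm_eq_abs, Real.norm_eq_abs, abs_of_pos hxi, one_mul] at this
    have h1 := (abs_le.1 this).2
    calc (G (Set.Ici x)).toReal ≤ (C + 1) * x⁻¹ := by linarith
      _ ≤ _ := by
        gcongr
        exact le_trans (by linarith [le_abs_self C]) (le_max_right _ _)
  · calc (G (Set.Ici x)).toReal ≤ 1 := measureReal_le_one
      _ = x * x⁻¹ := by field_simp
      _ ≤ _ := by
        gcongr
        exact le_trans (by linarith [le_abs_self x0]) (le_max_left _ _)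

lemma aux_lim (G : Measure ℝ) (C : ℝ)
    (htail : (fun x : ℝ => (G (Set.Ici x)).toReal - C * x⁻¹) =o[atTop] (fun x : ℝ => x⁻¹)) :
    Tendsto (fun x : ℝ => x * (G (Set.Ici x)).toReal) atTop (𝓝 C) := by
  have h := htail.tendsto_div_nhds_zero
  have h2 : Tendsto (fun x : ℝ => ((G (Set.Ici x)).toReal - C * x⁻¹) / x⁻¹ + C) atTop (𝓝 C) := by
    simpa using h.add_const C
  refine h2.congr' ?_
  filter_upwards [eventually_gt_atTop 0] with x hx
  field_simp
  ring

lemma aux_two (G : Measure ℝ) [IsProbabilityMeasure G]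
    (hsym : G.map (fun x => -x) = G) {y : ℝ} (hy : 0 < y) :
    (G {x | y ≤ |x|}).toReal = 2 * (G (Set.Ici y)).toReal := by
  have h1 : {x : ℝ | y ≤ |x|} = Set.Ici y ∪ Set.Iic (-y) := by
    ext x
    simp [le_abs, le_neg]
  have h2 : G (Set.Iic (-y)) = G (Set.Ici y) := by
    conv_rhs => rw [← hsym]
    rw [Measure.map_apply measurable_neg measurableSet_Ici]
    congr 1
    ext x
    simp [le_neg]
  rw [h1, measure_union _ measurableSet_Iic, h2, ENNReal.toReal_add (by simp) (by simp)]
  · ring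
  · rw [Set.disjoint_left]
    intro x hx hx'
    simp only [Set.mem_Ici, Set.mem_Iic] at hx hx'
    linarith

lemma aux_layer (G : Measure ℝ) [IsProbabilityMeasure G]
    (hsym : G.map (fun x => -x) = G) (t M : ℝ) (ht : 0 < t) (hM : 0 < M) :
    ∫ x, (1 - Real.cos (min (t * |x|) M)) ∂G =
      ∫ u in Set.Ioc (0:ℝ) M, Real.sin u * (2 * (G (Set.Ici (u / t))).toReal) := by
  have hmeas : MeasurableSet {p : ℝ × ℝ | p.2 ≤ t * |p.1|} :=
    measurableSet_le (by fun_prop) (by fun_prop)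
  have hint : Integrable (Function.uncurry fun (x u : ℝ) =>
      {p : ℝ × ℝ | p.2 ≤ t * |p.1|}.indicator (fun p => Real.sin p.2) (x, u))
      (G.prod (volume.restrict (Set.Ioc (0:ℝ) M))) := by
    refine Integrable.mono' (integrable_const (1:ℝ)) ?_ ?_
    · exact (Measurable.indicator (by fun_prop) hmeas).aestronglyMeasurable
    · refine Filter.Eventually.of_forall fun p => ?_
      simp only [Function.uncurry]
      refine (norm_indicator_le_norm_self _ _).trans ?_
      exact Real.abs_sin_le_one _
  have hsw := integral_integral_swap hint
  have hL : ∀ x : ℝ, 1 - Real.cos (min (t * |x|) M) = ∫ u in Set.Ioc (0:ℝ) M,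
      {p : ℝ × ℝ | p.2 ≤ t * |p.1|}.indicator (fun p => Real.sin p.2) (x, u) := by
    intro x
    have h0 : 0 ≤ min (t * |x|) M := le_min (by positivity) hM.le
    have : (fun u : ℝ => {p : ℝ × ℝ | p.2 ≤ t * |p.1|}.indicator (fun p => Real.sin p.2) (x, u))
      = (Set.Iic (t * |x|)).indicator Real.sin := by
      ext u
      simp [Set.indicator]
    rw [this, setIntegral_indicator measurableSet_Iic, Set.Ioc_inter_Iic, min_comm M,
      ← intervalIntegral.integral_of_le h0, integral_sin, Real.cos_zero]
  have hR : ∀ u ∈ Set.Ioc (0:ℝ) M, ∫ x,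
      {p : ℝ × ℝ | p.2 ≤ t * |p.1|}.indicator (fun p => Real.sin p.2) (x, u) ∂G =
      Real.sin u * (2 * (G (Set.Ici (u / t))).toReal) := by
    intro u hu
    have : (fun x : ℝ => {p : ℝ × ℝ | p.2 ≤ t * |p.1|}.indicator (fun p => Real.sin p.2) (x, u))
      = ({x : ℝ | u / t ≤ |x|}).indicator (fun _ => Real.sin u) := by
      ext x
      simp [Set.indicator, div_le_iff₀' ht]
    rw [this, integral_indicator_const _ (measurableSet_le (by fun_prop) (by fun_prop)),
      ← aux_two G hsym (div_pos hu.1 ht), smul_eq_mul, mul_comm]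
    rfl
  rw [← setIntegral_congr_fun measurableSet_Ioc hR, ← hsw]
  simp_rw [hL]

lemma aux_trunc (G : Measure ℝ) [IsProbabilityMeasure G]
    (hsym : G.map (fun x => -x) = G) (t M : ℝ) (ht : 0 < t) (hM : 0 < M) :
    |(∫ x, (1 - Real.cos (t * |x|)) ∂G) - ∫ x, (1 - Real.cos (min (t * |x|) M)) ∂G|
      ≤ 4 * (G (Set.Ici (M / t))).toReal := by
  have hb : ∀ f : ℝ → ℝ, Measurable f → Integrable (fun x => 1 - Real.cos (f x)) G := by
    intro f hf
    refine Integrable.mono' (integrable_const (2:ℝ)) (by fun_prop) (.of_forall fun x => ?_)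
    rw [Real.norm_eq_abs, abs_le]
    constructor <;> linarith [Real.cos_le_one (f x), Real.neg_one_le_cos (f x)]
  rw [← integral_sub (hb _ (by fun_prop)) (hb _ (by fun_prop))]
  have hm : MeasurableSet {x : ℝ | M / t ≤ |x|} := measurableSet_le (by fun_prop) (by fun_prop)
  have : ‖∫ x, ((1 - Real.cos (t * |x|)) - (1 - Real.cos (min (t * |x|) M))) ∂G‖ ≤
      ∫ x, ({x : ℝ | M / t ≤ |x|}).indicator (fun _ => (2:ℝ)) x ∂G := by
    refine norm_integral_le_of_norm_le ((integrable_const _).indicator hm) (.of_forall fun x => ?_)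
    by_cases hx : M / t ≤ |x|
    · rw [Set.indicator_of_mem (by exact hx), Real.norm_eq_abs, abs_le]
      constructor <;> linarith [Real.cos_le_one (t * |x|), Real.neg_one_le_cos (t * |x|),
        Real.cos_le_one (min (t * |x|) M), Real.neg_one_le_cos (min (t * |x|) M)]
    · rw [Set.indicator_of_notMem (by exact hx)]
      rw [div_le_iff₀' ht, not_le] at hx
      simp [min_eq_left hx.le]
  rw [integral_indicator_const _ hm, Real.norm_eq_abs, smul_eq_mul, Measure.real,
    aux_two G hsym (div_pos hM ht)] at this
  linarith

lemma aux_main (G : Measure ℝ) [IsProbabilityMeasure G]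
    (hsym : G.map (fun x => -x) = G) (C : ℝ) (hC : 0 < C)
    (htail : (fun x : ℝ => (G (Set.Ici x)).toReal - C * x⁻¹) =o[atTop] (fun x : ℝ => x⁻¹))
    (a : ℝ) (ha : 0 < a) :
    Tendsto (fun n : ℕ => (n:ℝ) * ∫ x, (1 - Real.cos (a / n * |x|)) ∂G) atTop (𝓝 (C * π * a)) := by
  obtain ⟨K, hK, hKb⟩ := aux_bound G C htail
  have hlim := aux_lim G C htail
  have hmid : ∀ M : ℝ, 0 < M → Tendsto
      (fun n : ℕ => (n:ℝ) * ∫ x, (1 - Real.cos (min (a / n * |x|) M)) ∂G) atTop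
      (𝓝 (∫ u in Set.Ioc (0:ℝ) M, 2 * C * a * (Real.sin u * u⁻¹))) := by
    intro M hM
    have h1 : Tendsto (fun n : ℕ => ∫ u in Set.Ioc (0:ℝ) M,
        (n:ℝ) * (Real.sin u * (2 * (G (Set.Ici (u / (a / n)))).toReal))) atTop
        (𝓝 (∫ u in Set.Ioc (0:ℝ) M, 2 * C * a * (Real.sin u * u⁻¹))) := by
      have hanti : Antitone (fun x : ℝ => (G (Set.Ici x)).toReal) := fun x y hxy =>
        ENNReal.toReal_mono (by simp) (measure_mono (Set.Ici_subset_Ici.2 hxy))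
      refine tendsto_integral_filter_of_dominated_convergence (fun _ => 2 * K * a) ?_ ?_ ?_ ?_
      · refine .of_forall fun n => ?_
        have : Measurable (fun u : ℝ => (G (Set.Ici (u / (a / n)))).toReal) :=
          hanti.measurable.comp (by fun_prop)
        exact Measurable.aestronglyMeasurable (by fun_prop)
      · filter_upwards [eventually_gt_atTop 0] with n hn
        have hn : (0:ℝ) < n := by exact_mod_cast hn
        filter_upwards [ae_restrict_mem measurableSet_Ioc] with u hu
        have hu0 := hu.1
        have h3 := hKb (u / (a / n)) (by positivity)
        have h4 : |Real.sin u| ≤ u := by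
          have := Real.abs_sin_le_abs (x := u)
          rwa [abs_of_pos hu0] at this
        rw [norm_mul, norm_mul, Real.norm_eq_abs, Real.norm_eq_abs, Real.norm_eq_abs,
          abs_of_pos hn, abs_of_nonneg (by positivity : 0 ≤ 2 * (G (Set.Ici (u / (a / n)))).toReal)]
        calc (n:ℝ) * (|Real.sin u| * (2 * (G (Set.Ici (u / (a / n)))).toReal))
            ≤ n * (u * (2 * (K * (u / (a / n))⁻¹))) := by gcongr
          _ = 2 * K * a := by field_simp
      · exact integrable_const _
      · filter_upwards [ae_restrict_mem measurableSet_Ioc] with u hu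
        have hu0 := hu.1
        have h5 : Tendsto (fun n : ℕ => u / (a / n)) atTop atTop := by
          have : Tendsto (fun n : ℕ => (u / a) * (n:ℝ)) atTop atTop :=
            tendsto_natCast_atTop_atTop.const_mul_atTop (by positivity)
          refine this.congr fun n => ?_
          rw [div_div_eq_mul_div]; ring
        have h6 := ((hlim.comp h5).const_mul (2 * a * Real.sin u * u⁻¹))
        convert h6.congr' ?_ using 2
        · ring
        · filter_upwards [eventually_gt_atTop 0] with n hn
          have hn : (0:ℝ) < n := by exact_mod_cast hn
          simp only [Function.comp]
          generalize (G (Set.Ici (u / (a / n)))).toReal = T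
          field_simp
    refine h1.congr' ?_
    filter_upwards [eventually_gt_atTop 0] with n hn
    have hn : (0:ℝ) < n := by exact_mod_cast hn
    rw [aux_layer G hsym _ M (by positivity) hM, integral_const_mul]
  rw [Metric.tendsto_nhds]
  intro ε hε
  obtain ⟨M, hM, hMe⟩ : ∃ M : ℝ, 0 < M ∧ (4 * K * a + 4 * C * a) / M < ε / 2 := by
    refine ⟨(4 * K * a + 4 * C * a) / (ε / 2) + 1, by positivity, ?_⟩
    rw [div_lt_iff₀ (by positivity)]
    have : ε / 2 * ((4 * K * a + 4 * C * a) / (ε / 2)) = 4 * K * a + 4 * C * a := by field_simp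
    linarith
  have hD := aux_dirichlet M hM
  have h7 := Metric.tendsto_nhds.1 (hmid M hM) (ε / 2) (by positivity)
  filter_upwards [h7, eventually_gt_atTop 0] with n h7 hn
  have hn : (0:ℝ) < n := by exact_mod_cast hn
  have h8 := aux_trunc G hsym (a / n) M (by positivity) hM
  have h9 := hKb (M / (a / n)) (by positivity)
  rw [Real.dist_eq, integral_const_mul] at h7
  rw [Real.dist_eq]
  generalize (∫ x, (1 - Real.cos (a / n * |x|)) ∂G) = I at *
  generalize (∫ x, (1 - Real.cos (min (a / n * |x|) M)) ∂G) = J at *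
  generalize (∫ u in Set.Ioc (0:ℝ) M, Real.sin u * u⁻¹) = D at *
  have e1 : |n * I - n * J| ≤ 4 * K * a / M := by
    rw [← mul_sub, abs_mul, abs_of_pos hn]
    calc n * |I - J| ≤ n * (4 * (K * (M / (a / n))⁻¹)) := by gcongr; linarith
      _ = _ := by field_simp
  have e2 : |2 * C * a * D - C * π * a| ≤ 4 * C * a / M := by
    have : 2 * C * a * D - C * π * a = 2 * C * a * (D - π / 2) := by ring
    rw [this, abs_mul, abs_of_pos (by positivity)]
    calc 2 * C * a * |D - π / 2| ≤ 2 * C * a * (2 / M) := by gcongr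
      _ = _ := by ring
  rw [add_div] at hMe
  have e3 := abs_lt.1 h7
  have e4 := abs_le.1 e1
  have e5 := abs_le.1 e2
  rw [abs_lt]
  constructor <;> linarith [e3.1, e3.2, e4.1, e4.2, e5.1, e5.2]

lemma aux_real (G : Measure ℝ) [IsProbabilityMeasure G]
    (hsym : G.map (fun x => -x) = G) (t : ℝ) :
    charFnR G t = 1 + ((-∫ x, (1 - Real.cos (|t| * |x|)) ∂G : ℝ) : ℂ) := by
  have hcos : Integrable (fun x => Real.cos (t * x)) G :=
    Integrable.mono' (integrable_const (1:ℝ)) (by fun_prop)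
      (.of_forall fun x => Real.abs_cos_le_one _)
  have hsin : Integrable (fun x => Real.sin (t * x)) G :=
    Integrable.mono' (integrable_const (1:ℝ)) (by fun_prop)
      (.of_forall fun x => Real.abs_sin_le_one _)
  have h0 : ∫ x, Real.sin (t * x) ∂G = 0 := by
    have h1 : ∫ x, Real.sin (t * x) ∂(G.map (fun x => -x)) = ∫ x, Real.sin (t * (-x)) ∂G :=
      integral_map (by fun_prop) (by fun_prop)
    rw [hsym] at h1
    simp only [mul_neg, Real.sin_neg, integral_neg] at h1
    linarith
  have h2 : charFnR G t = ((∫ x, Real.cos (t * x) ∂G : ℝ) : ℂ) +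
      ((∫ x, Real.sin (t * x) ∂G : ℝ) : ℂ) * Complex.I := by
    unfold charFnR
    rw [← integral_complex_ofReal, ← integral_complex_ofReal, ← integral_mul_const,
      ← integral_add hcos.ofReal (hsin.ofReal.mul_const _)]
    congr 1
    ext x
    rw [Complex.exp_mul_I, ← Complex.ofReal_cos, ← Complex.ofReal_sin]
  have h3 : ∀ x : ℝ, Real.cos (|t| * |x|) = Real.cos (t * x) := fun x => by
    rw [← abs_mul, Real.cos_abs]
  simp_rw [h3]
  rw [h2, h0, integral_sub (integrable_const _) hcos]
  simp

theorem charFn_pow_tendsto_cauchy_of_tails (G : Measure ℝ) [IsProbabilityMeasure G]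
    (hsym : G.map (fun x => -x) = G)
    (C : ℝ) (hC : 0 < C)
    (htail : (fun x : ℝ => (G (Set.Ici x)).toReal - C * x⁻¹) =o[atTop] (fun x : ℝ => x⁻¹)) :
    ∀ s : ℝ, Tendsto (fun n : ℕ => (charFnR G (s / n)) ^ n) atTop
      (𝓝 (Complex.exp ((-(C * π * |s|) : ℝ) : ℂ))) := by
  intro s
  have h0 : ∀ n : ℕ, charFnR G (s / n) =
      1 + ((-∫ x, (1 - Real.cos (|s| / n * |x|)) ∂G : ℝ) : ℂ) := by
    intro n
    rw [aux_real G hsym (s / n), abs_div, Nat.abs_cast]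
  simp_rw [h0]
  apply Complex.tendsto_one_add_pow_exp_of_tendsto
  rcases eq_or_ne s 0 with rfl | hs
  · simp
  · have h := (aux_main G hsym C hC htail |s| (abs_pos.2 hs)).neg
    have h2 := (Complex.continuous_ofReal.tendsto _).comp h
    refine h2.congr fun n => ?_
    simp
end

section
/- Let μ ∈ ℝ, a > 0, α > 0, and let F be the probability measure on ℝ with density f(x) = C (1 + a|x − μ|^α)^{−2/α} with respect to Lebesgue measure, where C > 0 is the normalizing constant. Then F is in the strict domain of attraction of a Cauchy probability distribution: there exist c ≥ 0 with c and m ∈ ℝ such that for every s ∈ ℝ, (φ_F(s/n))ⁿ → exp(−c|s| + i m s) as n → ∞. -/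
open MeasureTheory Filter Topology

theorem aux_bound_s16 (u : ℝ) : (1 - Real.cos u) * (u ^ 2)⁻¹ ≤ 4 * (1 + u ^ 2)⁻¹ := by
  by_cases hu : u = 0
  · subst hu; simp
  have h1 : 1 - u ^ 2 / 2 ≤ Real.cos u := Real.one_sub_sq_div_two_le_cos
  have h2 := Real.neg_one_le_cos u
  have hp : 0 < u ^ 2 := by positivity
  rw [← div_eq_mul_inv, ← div_eq_mul_inv, div_le_div_iff₀ hp (by positivity)]
  nlinarith

theorem aux_scale (a α t u : ℝ) (ha : 0 < a) (hα : 0 < α) (ht : 0 < t) :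
    (1 + a * |u / t| ^ α) ^ (-(2 / α)) = t ^ 2 * (t ^ α + a * |u| ^ α) ^ (-(2 / α)) := by
  have h0 : 0 < t ^ α := Real.rpow_pos_of_pos ht α
  have h1 : 1 + a * |u / t| ^ α = (t ^ α + a * |u| ^ α) * (t ^ α)⁻¹ := by
    rw [abs_div, abs_of_pos ht, Real.div_rpow (abs_nonneg u) ht.le]
    field_simp
  have h2 : 0 ≤ t ^ α + a * |u| ^ α := by positivity
  rw [h1, Real.mul_rpow h2 (by positivity), Real.inv_rpow h0.le, ← Real.rpow_neg h0.le,
    ← Real.rpow_mul ht.le, neg_neg, mul_div_cancel₀ _ hα.ne', mul_comm]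
  norm_num

theorem aux_dom (a α t u : ℝ) (ha : 0 < a) (hα : 0 < α) (ht : 0 < t) (hu : u ≠ 0) :
    (t ^ α + a * |u| ^ α) ^ (-(2 / α)) ≤ (a * |u| ^ α) ^ (-(2 / α)) := by
  have h0 : 0 < t ^ α := Real.rpow_pos_of_pos ht α
  have h1 : 0 < |u| ^ α := Real.rpow_pos_of_pos (abs_pos.2 hu) α
  have h2 : 0 < 2 / α := by positivity
  exact Real.rpow_le_rpow_of_nonpos (by positivity) (by linarith) (by linarith)

theorem aux_lim_eq (a α u : ℝ) (ha : 0 < a) (hα : 0 < α) :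
    (a * |u| ^ α) ^ (-(2 / α)) = a ^ (-(2 / α)) * (u ^ 2)⁻¹ := by
  rw [Real.mul_rpow ha.le (by positivity), ← Real.rpow_mul (abs_nonneg u)]
  have : α * -(2 / α) = -((2 : ℕ) : ℝ) := by push_cast; field_simp
  rw [this, Real.rpow_neg (abs_nonneg u), Real.rpow_natCast, sq_abs]

theorem aux_dct (a α : ℝ) (ha : 0 < a) (hα : 0 < α) :
    Tendsto (fun t : ℝ => ∫ u : ℝ, (1 - Real.cos u) * (t ^ α + a * |u| ^ α) ^ (-(2 / α)))
      (𝓝[>] 0) (𝓝 (∫ u : ℝ, (1 - Real.cos u) * (a * |u| ^ α) ^ (-(2 / α)))) := by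
  refine tendsto_integral_filter_of_dominated_convergence
    (fun u => a ^ (-(2 / α)) * (4 * (1 + u ^ 2)⁻¹)) ?_ ?_ ?_ ?_
  · refine Eventually.of_forall fun t => Measurable.aestronglyMeasurable ?_
    fun_prop
  · filter_upwards [self_mem_nhdsWithin] with t ht
    refine Eventually.of_forall fun u => ?_
    have ht : 0 < t := ht
    have hc : 0 ≤ 1 - Real.cos u := by linarith [Real.cos_le_one u]
    have ht' : 0 < t ^ α := Real.rpow_pos_of_pos ht α
    rw [Real.norm_of_nonneg (by positivity)]
    by_cases hu : u = 0
    · subst hu; simp; positivity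
    calc _ ≤ (1 - Real.cos u) * (a * |u| ^ α) ^ (-(2 / α)) :=
          mul_le_mul_of_nonneg_left (aux_dom a α t u ha hα ht hu) hc
      _ = a ^ (-(2 / α)) * ((1 - Real.cos u) * (u ^ 2)⁻¹) := by
          rw [aux_lim_eq a α u ha hα]; ring
      _ ≤ _ := mul_le_mul_of_nonneg_left (aux_bound_s16 u) (by positivity)
  · exact (integrable_inv_one_add_sq.const_mul 4).const_mul _
  · refine Eventually.of_forall fun u => ?_
    by_cases hu : u = 0
    · subst hu; simp
    have h1 : 0 < |u| ^ α := Real.rpow_pos_of_pos (abs_pos.2 hu) α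
    refine Tendsto.const_mul _ ?_
    have h2 : Tendsto (fun t : ℝ => t ^ α + a * |u| ^ α) (𝓝[>] 0) (𝓝 (a * |u| ^ α)) := by
      have h3 : Tendsto (fun t : ℝ => t ^ α) (𝓝[>] 0) (𝓝 0) := by
        have := (Real.continuousAt_rpow_const (0 : ℝ) α (Or.inr hα.le)).tendsto
        rw [Real.zero_rpow hα.ne'] at this
        exact this.mono_left nhdsWithin_le_nhds
      simpa using h3.add_const (a * |u| ^ α)
    exact h2.rpow_const (Or.inl (by positivity))

theorem aux_subst (a α C t : ℝ) (ha : 0 < a) (hα : 0 < α) (ht : 0 < t) :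
    ∫ x : ℝ, (1 - Real.cos (t * x)) * (C * (1 + a * |x| ^ α) ^ (-(2 / α))) =
      t * (C * ∫ u : ℝ, (1 - Real.cos u) * (t ^ α + a * |u| ^ α) ^ (-(2 / α))) := by
  have h := Measure.integral_comp_mul_left
    (fun u : ℝ => (1 - Real.cos u) * (C * (1 + a * |u / t| ^ α) ^ (-(2 / α)))) t
  have e1 : ∀ x : ℝ, t * x / t = x := fun x => by field_simp
  simp only [e1] at h
  rw [h, abs_of_pos (inv_pos.2 ht), smul_eq_mul, ← integral_const_mul, ← integral_const_mul,
    ← integral_const_mul]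
  refine integral_congr_ae (Eventually.of_forall fun u => ?_)
  simp only [aux_scale a α t u ha hα ht]
  field_simp

theorem aux_char (μ a α C t : ℝ) (ha : 0 < a) (hα : 0 < α) (hC : 0 < C)
    (hnorm : ∫ x : ℝ, C * (1 + a * |x - μ| ^ α) ^ (-(2 / α)) = 1) :
    charFnR (MeasureTheory.volume.withDensity
            (fun x => ENNReal.ofReal (C * (1 + a * |x - μ| ^ α) ^ (-(2 / α))))) t =
      Complex.exp (((t * μ : ℝ) : ℂ) * Complex.I) *
        ((1 - ∫ x : ℝ, (1 - Real.cos (t * x)) * (C * (1 + a * |x| ^ α) ^ (-(2 / α))) : ℝ) : ℂ) := by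
  set g : ℝ → ℝ := fun x => C * (1 + a * |x| ^ α) ^ (-(2 / α)) with hg
  have hgm : Measurable g := by fun_prop
  have hg0 : ∀ x, 0 ≤ g x := fun x => by simp only [hg]; positivity
  have hgn : ∀ x, g (-x) = g x := fun x => by simp [hg]
  have hn : ∫ x, g x = 1 := by
    rw [← hnorm]; exact (integral_sub_right_eq_self g μ).symm
  have hgi : Integrable g := by
    by_contra h
    rw [integral_undef h] at hn
    norm_num at hn
  change charFnR (volume.withDensity (fun x => ENNReal.ofReal (g (x - μ)))) t = _
  unfold charFnR
  have hmm : Measurable fun x => ENNReal.ofReal (g (x - μ)) :=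
    (hgm.comp (measurable_id.sub_const μ)).ennreal_ofReal
  rw [integral_withDensity_eq_integral_toReal_smul hmm
    (Eventually.of_forall fun x => ENNReal.ofReal_lt_top)]
  simp only [ENNReal.toReal_ofReal (hg0 _)]
  rw [← integral_add_right_eq_self _ μ]
  simp only [add_sub_cancel_right]
  have hsplit : ∀ x : ℝ, g x • Complex.exp (((t * (x + μ) : ℝ) : ℂ) * Complex.I) =
      Complex.exp (((t * μ : ℝ) : ℂ) * Complex.I) *
        ((g x : ℂ) * Complex.exp (((t * x : ℝ) : ℂ) * Complex.I)) := fun x => by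
    rw [Complex.real_smul, mul_left_comm, ← Complex.exp_add]
    congr 2; push_cast; ring
  simp only [hsplit]
  rw [integral_const_mul]
  congr 1
  have hci : Integrable (fun x => Real.cos (t * x) * g x) := by
    refine hgi.bdd_mul (c := 1) (by fun_prop) (Eventually.of_forall fun x => ?_)
    exact Real.abs_cos_le_one _
  have hsi : Integrable (fun x => Real.sin (t * x) * g x) := by
    refine hgi.bdd_mul (c := 1) (by fun_prop) (Eventually.of_forall fun x => ?_)
    exact Real.abs_sin_le_one _
  have hs0 : ∫ x, Real.sin (t * x) * g x = 0 := by
    have := integral_neg_eq_self (fun x => Real.sin (t * x) * g x) volume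
    simp only [hgn, mul_neg, Real.sin_neg, neg_mul, integral_neg] at this
    linarith
  have e : ∀ x : ℝ, (g x : ℂ) * Complex.exp (((t * x : ℝ) : ℂ) * Complex.I) =
      ((Real.cos (t * x) * g x : ℝ) : ℂ) + ((Real.sin (t * x) * g x : ℝ) : ℂ) * Complex.I :=
    fun x => by
      rw [Complex.exp_mul_I, ← Complex.ofReal_cos, ← Complex.ofReal_sin]; push_cast; ring
  simp only [e]
  have hci' : Integrable (fun x => ((Real.cos (t * x) * g x : ℝ) : ℂ)) := hci.ofReal
  have hsi' : Integrable (fun x => ((Real.sin (t * x) * g x : ℝ) : ℂ)) := hsi.ofReal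
  rw [integral_add hci' (hsi'.mul_const _), integral_mul_const, integral_complex_ofReal,
    integral_complex_ofReal, hs0]
  have e2 : ∀ x : ℝ, (1 - Real.cos (t * x)) * g x = g x - Real.cos (t * x) * g x :=
    fun x => by ring
  change _ = (((1 - ∫ x : ℝ, (1 - Real.cos (t * x)) * g x : ℝ)) : ℂ)
  simp only [e2]
  rw [integral_sub hgi hci, hn]
  simp

/-- Every Cauchy-like probability distribution, with density
`f(x) = C (1 + a|x − μ|^α)^{−2/α}`, is in the strict domain of attraction of a Cauchy
probability distribution. -/
theorem cauchy_like_domain_of_attraction (μ a α C : ℝ) (ha : 0 < a) (hα : 0 < α) (hC : 0 < C)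
    (hnorm : ∫ x : ℝ, C * (1 + a * |x - μ| ^ α) ^ (-(2 / α)) = 1) :
    ∃ c : ℝ, 0 ≤ c ∧ ∃ m : ℝ, ∀ s : ℝ,
      Tendsto
        (fun n : ℕ =>
          (charFnR (MeasureTheory.volume.withDensity
            (fun x => ENNReal.ofReal (C * (1 + a * |x - μ| ^ α) ^ (-(2 / α))))) (s / n)) ^ n)
        atTop
        (𝓝 (Complex.exp (((-(c * |s|) : ℝ) : ℂ) + ((m * s : ℝ) : ℂ) * Complex.I))) := by
  refine ⟨C * ∫ u : ℝ, (1 - Real.cos u) * (a * |u| ^ α) ^ (-(2 / α)), ?_, μ, fun s => ?_⟩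
  · refine mul_nonneg hC.le (integral_nonneg fun u => ?_)
    have hc : 0 ≤ 1 - Real.cos u := by linarith [Real.cos_le_one u]
    simp only [Pi.zero_apply]
    positivity
  simp only [aux_char μ a α C _ ha hα hC hnorm, mul_pow]
  set K : ℝ := C * ∫ u : ℝ, (1 - Real.cos u) * (a * |u| ^ α) ^ (-(2 / α)) with hK
  have key : Tendsto (fun n : ℕ => (n : ℝ) * -(∫ x : ℝ, (1 - Real.cos (s / n * x)) *
      (C * (1 + a * |x| ^ α) ^ (-(2 / α))))) atTop (𝓝 (-(K * |s|))) := by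
    by_cases hs : s = 0
    · subst hs; simp
    have hs' : 0 < |s| := abs_pos.2 hs
    have ht : Tendsto (fun n : ℕ => |s| / (n : ℝ)) atTop (𝓝[>] 0) := by
      refine tendsto_nhdsWithin_iff.2 ⟨tendsto_const_div_atTop_nhds_zero_nat _, ?_⟩
      filter_upwards [eventually_gt_atTop 0] with n hn
      have : (0 : ℝ) < n := by exact_mod_cast hn
      exact div_pos hs' this
    have h1 := ((((aux_dct a α ha hα).comp ht).const_mul C).mul_const |s|).neg
    refine h1.congr' ?_
    filter_upwards [eventually_gt_atTop 0] with n hn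
    have hn' : (0 : ℝ) < n := by exact_mod_cast hn
    have hcos : ∀ x : ℝ, Real.cos (s / n * x) = Real.cos (|s| / n * x) := fun x => by
      rcases abs_choice s with h | h
      · rw [h]
      · rw [h, ← Real.cos_neg]; congr 1; ring
    simp only [hcos]
    rw [aux_subst a α C _ ha hα (div_pos hs' hn')]
    simp only [Function.comp]
    field_simp
  have h2 := Real.tendsto_one_add_pow_exp_of_tendsto key
  have h3 := (Complex.continuous_ofReal.tendsto _).comp h2
  rw [Complex.exp_add, mul_comm]
  refine Tendsto.mul ?_ ?_
  · refine tendsto_const_nhds.congr' ?_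
    filter_upwards [eventually_gt_atTop 0] with n hn
    have hn' : (n : ℂ) ≠ 0 := by exact_mod_cast hn.ne'
    rw [← Complex.exp_nat_mul]
    congr 1; push_cast; field_simp
  · rw [← Complex.ofReal_exp]
    refine h3.congr fun n => ?_
    simp only [Function.comp]
    push_cast
    rw [sub_eq_add_neg]
end
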